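/- arXiv:2012.12372 — 6 statements merged into one kernel-verified Lean document; each statement's English description precedes it below -/
import Mathlib

section
/- (Lemma 2, closed form.) Fix an integer K ≥ 2, reals a ≥ 0, b ≥ 0 with a + b > 0, and a probability vector p ∈ ℝ^K. Define the sequence of vectors p̂_t ∈ ℝ^K (t = 0, 1, 2, …) by p̂_0 = (a·p + (b/K)·𝟙)/(a + b) and p̂_{t+1} = (a·p + b·p̂_t)/(a + b), where 𝟙 is the all-ones vector. Then for every t ≥ 0 and every k = 1, …, K, p̂_t(k) = p_k + (b/(a + b))^{t+1} · (1/K − p_k). Interpreting a = p_in(x), b = p_all(x), p_k = p_in(k|x), this is the Bayes optimal prediction at iteration t of the iterated soft-label self-training scheme. -/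
/-- Lemma 2, closed form: the iterates
`p̂_0 = (a p + (b/K) 𝟙)/(a+b)`, `p̂_{t+1} = (a p + b p̂_t)/(a+b)` satisfy
`p̂_t k = p k + (b/(a+b))^(t+1) (1/K - p k)`. -/
theorem stmt_6 {K : ℕ} (hK : 2 ≤ K) (a b : ℝ) (ha : 0 ≤ a) (hb : 0 ≤ b)
    (hab : 0 < a + b)
    (p : Fin K → ℝ) (hp0 : ∀ k, 0 ≤ p k) (hp1 : ∑ k, p k = 1)
    (phat : ℕ → Fin K → ℝ)
    (h0 : ∀ k, phat 0 k = (a * p k + b / (K : ℝ)) / (a + b))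
    (hrec : ∀ t k, phat (t + 1) k = (a * p k + b * phat t k) / (a + b)) :
    ∀ (t : ℕ) (k : Fin K),
      phat t k = p k + (b / (a + b)) ^ (t + 1) * (1 / (K : ℝ) - p k) := by
  have hne : a + b ≠ 0 := hab.ne'
  have key : ∀ (x y : ℝ), (a * x + b * y) / (a + b) = x + b / (a + b) * (y - x) := by
    intro x y
    field_simp
    ring
  intro t k
  induction t with
  | zero =>
    have h := key (p k) (1 / (K : ℝ))
    rw [h0, div_eq_mul_one_div b (K : ℝ), h, zero_add, pow_one]
  | succ t ih =>
    rw [hrec, key, ih, pow_succ (b / (a + b)) (t + 1)]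
    ring
end

section
/- Fix an integer K ≥ 2, reals a ≥ 0, b ≥ 0 with a + b > 0, and a probability vector p ∈ ℝ^K. Define the sequence p̂_t ∈ ℝ^K by p̂_0 = (a·p + (b/K)·𝟙)/(a + b) and p̂_{t+1} = (a·p + b·p̂_t)/(a + b). Then: (i) if a > 0, then for every k, p̂_t(k) → p_k as t → ∞; (ii) if a = 0 (and hence b > 0), then p̂_t(k) = 1/K for every t ≥ 0 and every k. In particular, the limiting classifier is the perfect out-distribution aware classifier: Bayes optimal on the in-distribution (p_in(x) > 0) and maximally uncertain where p_in(x) = 0. -/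
/-- for the self-training iterates
`p̂_0 = (a p + (b/K) 𝟙)/(a+b)`, `p̂_{t+1} = (a p + b p̂_t)/(a+b)`:
(i) if `a > 0` then `p̂_t k → p k` as `t → ∞`;
(ii) if `a = 0` then `p̂_t k = 1/K` for all `t, k`. -/
theorem stmt_7 {K : ℕ} (hK : 2 ≤ K) (a b : ℝ) (ha : 0 ≤ a) (hb : 0 ≤ b)
    (hab : 0 < a + b)
    (p : Fin K → ℝ) (hp0 : ∀ k, 0 ≤ p k) (hp1 : ∑ k, p k = 1)
    (phat : ℕ → Fin K → ℝ)
    (h0 : ∀ k, phat 0 k = (a * p k + b / (K : ℝ)) / (a + b))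
    (hrec : ∀ t k, phat (t + 1) k = (a * p k + b * phat t k) / (a + b)) :
    (0 < a → ∀ k, Filter.Tendsto (fun t => phat t k) Filter.atTop (nhds (p k))) ∧
    (a = 0 → ∀ (t : ℕ) (k : Fin K), phat t k = 1 / (K : ℝ)) := by
  have hne : a + b ≠ 0 := hab.ne'
  constructor
  · intro hapos k
    have hform : ∀ t, phat t k = p k + (b / (a + b)) ^ t * (phat 0 k - p k) := by
      intro t
      induction t with
      | zero => simp
      | succ n ih =>
        rw [hrec, ih, pow_succ]
        field_simp
        ring
    have hr : Filter.Tendsto (fun t : ℕ => (b / (a + b)) ^ t) Filter.atTop (nhds 0) := by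
      apply tendsto_pow_atTop_nhds_zero_of_lt_one
      · positivity
      · rw [div_lt_one hab]; linarith
    have h2 := (hr.mul_const (phat 0 k - p k)).const_add (p k)
    rw [zero_mul, add_zero] at h2
    exact h2.congr (fun t => (hform t).symm)
  · intro ha0 t k
    subst ha0
    have hb0 : b ≠ 0 := by simpa using hne
    have hK0 : (K : ℝ) ≠ 0 := by
      have : K ≠ 0 := by omega
      exact_mod_cast this
    induction t with
    | zero => rw [h0, zero_mul, zero_add, zero_add]; field_simp
    | succ n ih => rw [hrec, ih, zero_mul, zero_add, zero_add]; field_simp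
end

section
/- Fix an integer K ≥ 2, reals a > 0, b ≥ 0, and a probability vector p ∈ ℝ^K. Define the sequence p̂_t ∈ ℝ^K by p̂_0 = (a·p + (b/K)·𝟙)/(a + b) and p̂_{t+1} = (a·p + b·p̂_t)/(a + b). Then for every t ≥ 0 and all indices k, l: p̂_t(k) > p̂_t(l) if and only if p_k > p_l, and p̂_t(k) = p̂_t(l) if and only if p_k = p_l. Consequently argmax_k p̂_t(k) = argmax_k p_k, i.e., the Bayes optimal decision of each self-training iterate coincides with the Bayes optimal decision for the in-distribution conditional probabilities p. -/
/-- for `a > 0`, each self-training iterate `p̂_t` induces the same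
ordering of the classes as `p`: `p̂_t k > p̂_t l ↔ p k > p l` and
`p̂_t k = p̂_t l ↔ p k = p l`; consequently the set of maximizers (argmax) of
`p̂_t` coincides with that of `p`. -/
theorem stmt_10 {K : ℕ} (hK : 2 ≤ K) (a b : ℝ) (ha : 0 < a) (hb : 0 ≤ b)
    (p : Fin K → ℝ) (hp0 : ∀ k, 0 ≤ p k) (hp1 : ∑ k, p k = 1)
    (phat : ℕ → Fin K → ℝ)
    (h0 : ∀ k, phat 0 k = (a * p k + b / (K : ℝ)) / (a + b))
    (hrec : ∀ t k, phat (t + 1) k = (a * p k + b * phat t k) / (a + b)) :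
    (∀ (t : ℕ) (k l : Fin K),
      (phat t k > phat t l ↔ p k > p l) ∧ (phat t k = phat t l ↔ p k = p l)) ∧
    (∀ t : ℕ,
      {k : Fin K | ∀ l, phat t l ≤ phat t k} = {k : Fin K | ∀ l, p l ≤ p k}) := by
  have hab : 0 < a + b := by linarith
  have key : ∀ t : ℕ, ∃ c : ℝ, 0 < c ∧ ∀ k l, phat t k - phat t l = c * (p k - p l) := by
    intro t
    induction t with
    | zero =>
      refine ⟨a / (a + b), by positivity, fun k l => ?_⟩
      rw [h0, h0]
      ring
    | succ t ih =>
      obtain ⟨c, hc, h⟩ := ih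
      refine ⟨(a + b * c) / (a + b), by positivity, fun k l => ?_⟩
      rw [hrec, hrec, ← sub_div, div_mul_eq_mul_div]
      congr 1
      linear_combination b * h k l
  have lt : ∀ (t : ℕ) (k l : Fin K), phat t k > phat t l ↔ p k > p l := by
    intro t k l
    obtain ⟨c, hc, h⟩ := key t
    rw [gt_iff_lt, gt_iff_lt, ← sub_pos, h, mul_pos_iff_of_pos_left hc, sub_pos]
  refine ⟨fun t k l => ⟨lt t k l, ?_⟩, fun t => ?_⟩
  · obtain ⟨c, hc, h⟩ := key t
    rw [← sub_eq_zero, h, mul_eq_zero, or_iff_right hc.ne', sub_eq_zero]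
  · ext k
    simp only [Set.mem_setOf_eq]
    refine forall_congr' fun l => ?_
    rw [← not_lt, ← not_lt]
    exact not_congr (lt t l k)
end

section
/- Fix an integer K ≥ 2, reals a ≥ 0, b ≥ 0 with a + b > 0, and a probability vector p ∈ ℝ^K. Define the sequence p̂_t ∈ ℝ^K by p̂_0 = (a·p + (b/K)·𝟙)/(a + b) and p̂_{t+1} = (a·p + b·p̂_t)/(a + b). Then for every t ≥ 0: (i) 1/K ≤ max_k p̂_t(k) ≤ max_k p_k, (ii) max_k p̂_{t+1}(k) ≥ max_k p̂_t(k), i.e., the confidence of the Bayes optimal self-training iterates is nondecreasing in t and never exceeds the true in-distribution confidence max_k p_k. -/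
/-- the confidence `max_k p̂_t k` of the Bayes optimal self-training
iterates satisfies `1/K ≤ max_k p̂_t k ≤ max_k p k` and is nondecreasing in `t`. -/
theorem stmt_11 {K : ℕ} (hK : 2 ≤ K) (a b : ℝ) (ha : 0 ≤ a) (hb : 0 ≤ b)
    (hab : 0 < a + b)
    (p : Fin K → ℝ) (hp0 : ∀ k, 0 ≤ p k) (hp1 : ∑ k, p k = 1)
    (phat : ℕ → Fin K → ℝ)
    (h0 : ∀ k, phat 0 k = (a * p k + b / (K : ℝ)) / (a + b))
    (hrec : ∀ t k, phat (t + 1) k = (a * p k + b * phat t k) / (a + b)) :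
    ∀ t : ℕ,
      1 / (K : ℝ) ≤
        Finset.univ.sup' ⟨⟨0, by omega⟩, Finset.mem_univ _⟩ (phat t) ∧
      Finset.univ.sup' ⟨⟨0, by omega⟩, Finset.mem_univ _⟩ (phat t) ≤
        Finset.univ.sup' ⟨⟨0, by omega⟩, Finset.mem_univ _⟩ p ∧
      Finset.univ.sup' ⟨⟨0, by omega⟩, Finset.mem_univ _⟩ (phat t) ≤
        Finset.univ.sup' ⟨⟨0, by omega⟩, Finset.mem_univ _⟩ (phat (t + 1)) := by
  have hne : (Finset.univ : Finset (Fin K)).Nonempty := ⟨⟨0, by omega⟩, Finset.mem_univ _⟩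
  have hKpos : (0 : ℝ) < K := by
    have : 0 < K := by omega
    exact_mod_cast this
  obtain ⟨j, -, hj⟩ := Finset.exists_max_image Finset.univ p hne
  have hM : 1 / (K : ℝ) ≤ p j := by
    have h := Finset.sum_le_card_nsmul Finset.univ p (p j) hj
    rw [hp1] at h
    simp only [Finset.card_univ, Fintype.card_fin, nsmul_eq_mul] at h
    rw [div_le_iff₀ hKpos]
    linarith
  have key : ∀ t, 1 / (K : ℝ) ≤ phat t j ∧ phat t j ≤ p j ∧ ∀ k, phat t k ≤ phat t j := by
    intro t
    induction t with
    | zero =>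
      have e : b / (K : ℝ) = b * (1 / (K : ℝ)) := by ring
      refine ⟨?_, ?_, ?_⟩
      · rw [h0, le_div_iff₀ hab, e]
        nlinarith [mul_le_mul_of_nonneg_left hM ha]
      · rw [h0, div_le_iff₀ hab, e]
        nlinarith [mul_le_mul_of_nonneg_left hM hb]
      · intro k
        rw [h0, h0, div_le_div_iff_of_pos_right hab]
        linarith [mul_le_mul_of_nonneg_left (hj k (Finset.mem_univ k)) ha]
    | succ t ih =>
      obtain ⟨h1, h2, h3⟩ := ih
      refine ⟨?_, ?_, ?_⟩
      · rw [hrec, le_div_iff₀ hab]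
        linarith [mul_le_mul_of_nonneg_left hM ha, mul_le_mul_of_nonneg_left h1 hb]
      · rw [hrec, div_le_iff₀ hab]
        linarith [mul_le_mul_of_nonneg_left h2 hb]
      · intro k
        rw [hrec, hrec, div_le_div_iff_of_pos_right hab]
        linarith [mul_le_mul_of_nonneg_left (hj k (Finset.mem_univ k)) ha,
          mul_le_mul_of_nonneg_left (h3 k) hb]
  intro t
  obtain ⟨h1, h2, h3⟩ := key t
  refine ⟨h1.trans (Finset.le_sup' (phat t) (Finset.mem_univ j)), ?_, ?_⟩
  · exact Finset.sup'_le _ _ fun k _ =>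
      ((h3 k).trans h2).trans (Finset.le_sup' p (Finset.mem_univ j))
  · refine Finset.sup'_le _ _ fun k _ =>
      ((h3 k).trans ?_).trans (Finset.le_sup' (phat (t + 1)) (Finset.mem_univ j))
    rw [hrec, le_div_iff₀ hab]
    linarith [mul_le_mul_of_nonneg_left h2 ha]
end

section
/- Fix an integer K ≥ 2, reals a ≥ 0, b ≥ 0 with a + b > 0, and a probability vector p ∈ ℝ^K. Define the sequence p̂_t ∈ ℝ^K by p̂_0 = (a·p + (b/K)·𝟙)/(a + b) and p̂_{t+1} = (a·p + b·p̂_t)/(a + b). Then the total variation style distance satisfies ∑_{k=1}^K |p̂_t(k) − p_k| = (b/(a + b))^{t+1} · ∑_{k=1}^K |p_k − 1/K| for every t ≥ 0; in particular, for a > 0 the ℓ¹ distance between the self-training iterate and the true conditional distribution decreases geometrically in t with rate b/(a + b). -/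
/-- the ℓ¹ distance between the self-training iterate and the true
conditional distribution satisfies
`∑ k |p̂_t k - p k| = (b/(a+b))^(t+1) ∑ k |p k - 1/K|`. -/
theorem stmt_15 {K : ℕ} (hK : 2 ≤ K) (a b : ℝ) (ha : 0 ≤ a) (hb : 0 ≤ b)
    (hab : 0 < a + b)
    (p : Fin K → ℝ) (hp0 : ∀ k, 0 ≤ p k) (hp1 : ∑ k, p k = 1)
    (phat : ℕ → Fin K → ℝ)
    (h0 : ∀ k, phat 0 k = (a * p k + b / (K : ℝ)) / (a + b))
    (hrec : ∀ t k, phat (t + 1) k = (a * p k + b * phat t k) / (a + b)) :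
    ∀ t : ℕ,
      ∑ k, |phat t k - p k| =
        (b / (a + b)) ^ (t + 1) * ∑ k, |p k - 1 / (K : ℝ)| := by
  have hne : a + b ≠ 0 := hab.ne'
  have key : ∀ (t : ℕ) (k : Fin K),
      phat t k - p k = (b / (a + b)) ^ (t + 1) * (1 / (K : ℝ) - p k) := by
    intro t k
    induction t with
    | zero =>
      rw [h0, div_eq_mul_one_div b (K : ℝ), zero_add, pow_one]
      generalize 1 / (K : ℝ) = c
      field_simp
      ring
    | succ t ih =>
      have h1 : phat (t + 1) k - p k = b / (a + b) * (phat t k - p k) := by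
        rw [hrec]
        field_simp
        ring
      rw [h1, ih]
      ring
  intro t
  rw [Finset.mul_sum]
  refine Finset.sum_congr rfl fun k _ => ?_
  have hn : 0 ≤ (b / (a + b)) ^ (t + 1) := by positivity
  rw [key, abs_mul, abs_of_nonneg hn, abs_sub_comm]
end

section
/- Fix an integer K ≥ 2, reals a ≥ 0, b ≥ 0 with a + b > 0, and a probability vector p ∈ ℝ^K. Define the sequence p̂_t ∈ ℝ^K by p̂_0 = (a·p + (b/K)·𝟙)/(a + b) and p̂_{t+1} = (a·p + b·p̂_t)/(a + b). Then for every t ≥ 0, min_k p̂_{t+1}(k) ≤ min_k p̂_t(k) and min_k p_k ≤ min_k p̂_t(k) ≤ 1/K, i.e., the minimal class probability of the Bayes optimal self-training iterates is nonincreasing in t, bounded below by min_k p_k and bounded above by 1/K. -/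
/-- the minimal class probability `min_k p̂_t k` of the Bayes
optimal self-training iterates is nonincreasing in `t`, bounded below by
`min_k p k` and bounded above by `1/K`. -/
theorem stmt_16 {K : ℕ} (hK : 2 ≤ K) (a b : ℝ) (ha : 0 ≤ a) (hb : 0 ≤ b)
    (hab : 0 < a + b)
    (p : Fin K → ℝ) (hp0 : ∀ k, 0 ≤ p k) (hp1 : ∑ k, p k = 1)
    (phat : ℕ → Fin K → ℝ)
    (h0 : ∀ k, phat 0 k = (a * p k + b / (K : ℝ)) / (a + b))
    (hrec : ∀ t k, phat (t + 1) k = (a * p k + b * phat t k) / (a + b)) :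
    ∀ t : ℕ,
      Finset.univ.inf' ⟨⟨0, by omega⟩, Finset.mem_univ _⟩ (phat (t + 1)) ≤
        Finset.univ.inf' ⟨⟨0, by omega⟩, Finset.mem_univ _⟩ (phat t) ∧
      Finset.univ.inf' ⟨⟨0, by omega⟩, Finset.mem_univ _⟩ p ≤
        Finset.univ.inf' ⟨⟨0, by omega⟩, Finset.mem_univ _⟩ (phat t) ∧
      Finset.univ.inf' ⟨⟨0, by omega⟩, Finset.mem_univ _⟩ (phat t) ≤
        1 / (K : ℝ) := by
  have hKpos : (0 : ℝ) < K := by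
    have : 0 < K := by omega
    exact_mod_cast this
  obtain ⟨j, -, hj⟩ := Finset.exists_min_image (Finset.univ : Finset (Fin K)) p
    ⟨⟨0, by omega⟩, Finset.mem_univ _⟩
  have hj' : ∀ k, p j ≤ p k := fun k => hj k (Finset.mem_univ k)
  have hm : p j ≤ 1 / (K : ℝ) := by
    rw [le_div_iff₀ hKpos]
    have h : ∑ _k : Fin K, p j ≤ ∑ k, p k := Finset.sum_le_sum fun k _ => hj' k
    rw [hp1] at h
    simp at h
    linarith
  obtain ⟨s, hs⟩ : ∃ s, s = b / (a + b) := ⟨_, rfl⟩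
  have hs0 : 0 ≤ s := by rw [hs]; positivity
  have hs1 : s ≤ 1 := by rw [hs, div_le_one hab]; linarith
  have h0' : ∀ k, phat 0 k = (1 - s) * p k + s * (1 / (K : ℝ)) := by
    intro k
    rw [h0, hs]
    field_simp
    ring
  have hrec' : ∀ t k, phat (t + 1) k = (1 - s) * p k + s * phat t k := by
    intro t k
    rw [hrec, hs]
    field_simp
    ring
  have key : ∀ t, p j ≤ phat t j ∧ phat t j ≤ 1 / (K : ℝ) ∧ ∀ k, phat t j ≤ phat t k := by
    intro t
    induction t with
    | zero =>
      refine ⟨?_, ?_, fun k => ?_⟩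
      · rw [h0']; nlinarith
      · rw [h0']; nlinarith
      · rw [h0', h0']; nlinarith [hj' k]
    | succ t ih =>
      obtain ⟨h1, h2, h3⟩ := ih
      refine ⟨?_, ?_, fun k => ?_⟩
      · rw [hrec']; nlinarith
      · rw [hrec']; nlinarith
      · rw [hrec', hrec']
        nlinarith [mul_nonneg (sub_nonneg.2 hs1) (sub_nonneg.2 (hj' k)),
          mul_nonneg hs0 (sub_nonneg.2 (h3 k))]
  intro t
  obtain ⟨h1, h2, h3⟩ := key t
  refine ⟨?_, ?_, ?_⟩
  · refine Finset.le_inf' _ _ fun k _ => ?_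
    refine (Finset.inf'_le _ (Finset.mem_univ j)).trans (le_trans ?_ (h3 k))
    rw [hrec']; nlinarith
  · refine Finset.le_inf' _ _ fun k _ => ?_
    exact (Finset.inf'_le _ (Finset.mem_univ j)).trans (h1.trans (h3 k))
  · exact (Finset.inf'_le _ (Finset.mem_univ j)).trans h2
end
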